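/- Let G be a finite pseudoreflection subgroup of GL(n,ℂ) with d = |G|, let θ₁,…,θₙ be a homogeneous system of parameters for G with degrees d_i = deg θ_i, and let p₁,…,p_d be a basis of ℂ[z] as a module over ℂ[z]^G consisting of homogeneous polynomials, with degrees e_j = deg p_j. Then the polynomial identity Σ_{j=1}^d t^{e_j} = ∏_{i=1}^n (1 + t + ⋯ + t^{d_i−1}) holds in ℤ[t]. -/

import Mathlib

open MvPolynomial

noncomputable section

/-- The natural action of an invertible matrix on `ℂⁿ` by matrix-vector multiplication. -/
def gAct {n : ℕ} (σ : GL (Fin n) ℂ) (z : Fin n → ℂ) : Fin n → ℂ :=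
  Matrix.mulVec (σ : Matrix (Fin n) (Fin n) ℂ) z

/-- A pseudoreflection: an element of finite order in `GL(n,ℂ)` with `rank (1 - ρ) = 1`. -/
def IsPseudoreflection {n : ℕ} (ρ : GL (Fin n) ℂ) : Prop :=
  IsOfFinOrder ρ ∧ Matrix.rank ((1 : Matrix (Fin n) (Fin n) ℂ) - (ρ : Matrix (Fin n) (Fin n) ℂ)) = 1

/-- A subgroup of `GL(n,ℂ)` is a pseudoreflection group if it is generated by the
pseudoreflections it contains. -/
def IsPseudoreflectionGroup {n : ℕ} (G : Subgroup (GL (Fin n) ℂ)) : Prop :=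
  Subgroup.closure {ρ : GL (Fin n) ℂ | ρ ∈ G ∧ IsPseudoreflection ρ} = G

/-- The action of `σ ∈ GL(n,ℂ)` on polynomials: `(σ·p)(z) = p(σ⁻¹z)`. -/
def polyAct {n : ℕ} (σ : GL (Fin n) ℂ) (p : MvPolynomial (Fin n) ℂ) : MvPolynomial (Fin n) ℂ :=
  MvPolynomial.aeval
    (fun i => ∑ j, MvPolynomial.C (((σ⁻¹ : GL (Fin n) ℂ) : Matrix (Fin n) (Fin n) ℂ) i j)
      * MvPolynomial.X j) p

/-- The polynomial map `θ : ℂⁿ → ℂⁿ` associated to a tuple of polynomials. -/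
def polyMap {n : ℕ} (θ : Fin n → MvPolynomial (Fin n) ℂ) (z : Fin n → ℂ) : Fin n → ℂ :=
  fun i => MvPolynomial.eval z (θ i)

theorem finrank_homogeneousSubmodule_eq_card {K σ ι : Type*} [Field K]
    (b : Module.Basis ι K (MvPolynomial σ K)) (deg : ι → ℕ)
    (hb : ∀ i, (b i).IsHomogeneous (deg i)) (m : ℕ) :
    Module.finrank K (homogeneousSubmodule σ K m) = Nat.card {i // deg i = m} := by
  have hspan : homogeneousSubmodule σ K m =
      Submodule.span K (Set.range fun i : {i // deg i = m} => b i) := by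
    apply le_antisymm
    · intro q hq
      have hle : (⊤ : Submodule K (MvPolynomial σ K)) ≤
          (Submodule.span K (Set.range fun i : {i // deg i = m} => b i)).comap
            (homogeneousComponent m) := by
        rw [← b.span_eq, Submodule.span_le]
        rintro _ ⟨i, rfl⟩
        rw [SetLike.mem_coe, Submodule.mem_comap, homogeneousComponent_of_mem (hb i)]
        split_ifs with h
        · exact Submodule.subset_span ⟨⟨i, h.symm⟩, rfl⟩
        · exact Submodule.zero_mem _
      have := hle (Submodule.mem_top (x := q))
      rwa [Submodule.mem_comap, homogeneousComponent_eq_self hq] at this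
    · rw [Submodule.span_le]
      rintro _ ⟨i, rfl⟩
      have := hb i
      rw [i.2] at this
      exact this
  have hli : LinearIndependent K fun i : {i // deg i = m} => b i :=
    b.linearIndependent.comp _ Subtype.val_injective
  rw [hspan, Module.finrank_eq_nat_card_basis (Module.Basis.span hli)]

/-- Exponent vectors of weight `m` correspond to the vectors with sum `m` whose `i`-th entry is
divisible by the `i`-th weight. -/
def weightFiberEquiv {σ : Type*} [Fintype σ] [DecidableEq σ] (w : σ → ℕ) (hw : ∀ i, 0 < w i)
    (m : ℕ) :
    {a : σ →₀ ℕ // ∑ i, w i * a i = m} ≃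
      {l // l ∈ (Finset.finsuppAntidiag Finset.univ m).filter fun l : σ →₀ ℕ => ∀ i, w i ∣ l i} where
  toFun a := ⟨Finsupp.equivFunOnFinite.symm fun i => w i * a.1 i, by simpa using a.2⟩
  invFun l := ⟨Finsupp.equivFunOnFinite.symm fun i => l.1 i / w i, by
    obtain ⟨l, hl⟩ := l
    simp only [Finset.mem_filter, Finset.mem_finsuppAntidiag] at hl
    exact (Finset.sum_congr rfl fun i _ => Nat.mul_div_cancel' (hl.2 i)).trans hl.1.1⟩
  left_inv a := by
    ext i
    simp [Nat.mul_div_cancel_left _ (hw i)]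
  right_inv l := by
    obtain ⟨l, hl⟩ := l
    simp only [Finset.mem_filter] at hl
    ext i
    simpa using Nat.mul_div_cancel' (hl.2 i)

/-- The generating function `∏ᵢ 1 / (1 - X ^ wᵢ)` of exponent vectors by weight. -/
def weightSeries {σ : Type*} [Fintype σ] (w : σ → ℕ) : PowerSeries ℤ :=
  ∏ i, PowerSeries.mk fun k => if w i ∣ k then 1 else 0

theorem coeff_weightSeries {σ : Type*} [Fintype σ] (w : σ → ℕ) (hw : ∀ i, 0 < w i) (m : ℕ) :
    PowerSeries.coeff m (weightSeries w) = Nat.card {a : σ →₀ ℕ // ∑ i, w i * a i = m} := by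
  classical
  rw [Nat.card_congr (weightFiberEquiv w hw m), weightSeries, PowerSeries.coeff_prod,
    Nat.card_eq_fintype_card, Fintype.card_coe, Finset.card_filter, Nat.cast_sum]
  refine Finset.sum_congr rfl fun l _ => ?_
  simp only [PowerSeries.coeff_mk, Finset.prod_ite_zero, Finset.prod_const_one, Finset.mem_univ,
    true_imp_iff, Nat.cast_ite, Nat.cast_one, Nat.cast_zero]

theorem prod_one_sub_mul_weightSeries {σ : Type*} [Fintype σ] (w : σ → ℕ) (hw : ∀ i, 0 < w i) :
    (∏ i, (1 - PowerSeries.X ^ w i)) * weightSeries w = 1 := by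
  rw [weightSeries, ← Finset.prod_mul_distrib]
  refine Finset.prod_eq_one fun i _ => ?_
  ext k
  rw [sub_mul, one_mul, map_sub, PowerSeries.coeff_X_pow_mul', PowerSeries.coeff_one]
  simp only [PowerSeries.coeff_mk]
  rcases Nat.eq_zero_or_pos k with rfl | hk
  · simp [(hw i).ne']
  · by_cases h : w i ≤ k
    · have hdvd : w i ∣ k - w i ↔ w i ∣ k := Nat.dvd_sub_self_right.trans
        ⟨fun h' => h'.elim id fun h'' => (le_antisymm h h'').dvd, Or.inl⟩
      simp [h, hk.ne', hdvd]
    · simp [h, hk.ne', Nat.not_dvd_of_pos_of_lt hk (not_le.mp h)]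

theorem coeff_sum_X_pow_mul_weightSeries {σ κ : Type*} [Fintype σ] [Fintype κ] (w : σ → ℕ)
    (hw : ∀ i, 0 < w i) (e : κ → ℕ) (m : ℕ) :
    PowerSeries.coeff m ((∑ j, (PowerSeries.X : PowerSeries ℤ) ^ e j) * weightSeries w) =
      Nat.card {x : (σ →₀ ℕ) × κ // ∑ i, w i * x.1 i + e x.2 = m} := by
  classical
  have hfin (m : ℕ) : Finite {a : σ →₀ ℕ // ∑ i, w i * a i = m} :=
    Finite.of_equiv _ (weightFiberEquiv w hw m).symm
  have hsum (j : κ) (m : ℕ) : Finite {a : σ →₀ ℕ // ∑ i, w i * a i + e j = m} :=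
    Finite.of_injective
      (fun a => (⟨a.1, by have := a.2; omega⟩ : {a : σ →₀ ℕ // ∑ i, w i * a i = m - e j}))
      fun a b h => Subtype.ext (Subtype.mk.inj h)
  let f : {x : (σ →₀ ℕ) × κ // ∑ i, w i * x.1 i + e x.2 = m} ≃
      Σ j : κ, {a : σ →₀ ℕ // ∑ i, w i * a i + e j = m} :=
    { toFun x := ⟨x.1.2, x.1.1, x.2⟩
      invFun y := ⟨(y.2.1, y.1), y.2.2⟩
      left_inv _ := rfl
      right_inv _ := rfl }
  rw [Nat.card_congr f, Nat.card_sigma, Finset.sum_mul, map_sum, Nat.cast_sum]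
  refine Finset.sum_congr rfl fun j _ => ?_
  rw [PowerSeries.coeff_X_pow_mul']
  split_ifs with h
  · rw [coeff_weightSeries w hw]
    congr 1
    exact Nat.card_congr (Equiv.subtypeEquivRight fun a => by omega)
  · have : IsEmpty {a : σ →₀ ℕ // ∑ i, w i * a i + e j = m} := ⟨fun a => by have := a.2; omega⟩
    simp

/-- Comparing the monomial basis with a homogeneous basis of the form `θ ^ a * p j` determines the
generating function of the degrees of the `p j`. -/
theorem sum_X_pow_eq_prod_of_basis {K σ κ : Type*} [Field K] [Fintype σ] [Fintype κ]
    (w : σ → ℕ) (hw : ∀ i, 0 < w i) (e : κ → ℕ)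
    (b : Module.Basis ((σ →₀ ℕ) × κ) K (MvPolynomial σ K))
    (hb : ∀ x, (b x).IsHomogeneous (∑ i, w i * x.1 i + e x.2)) :
    ∑ j, (Polynomial.X : Polynomial ℤ) ^ e j =
      ∏ i, ∑ k ∈ Finset.range (w i), (Polynomial.X : Polynomial ℤ) ^ k := by
  have hseries : (∑ j, PowerSeries.X ^ e j) * weightSeries w =
      weightSeries fun _ : σ => 1 := by
    ext m
    rw [coeff_sum_X_pow_mul_weightSeries w hw, coeff_weightSeries _ fun _ => one_pos,
      ← finrank_homogeneousSubmodule_eq_card b _ hb m,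
      ← finrank_homogeneousSubmodule_eq_card (basisMonomials σ K) _ _ m]
    intro a
    rw [coe_basisMonomials]
    exact isHomogeneous_monomial _ (by simp [Finsupp.degree_eq_sum])
  apply Polynomial.coe_injective ℤ
  have hgeom : (∏ i, (1 - (PowerSeries.X : PowerSeries ℤ) ^ w i)) =
      (∏ i, ∑ k ∈ Finset.range (w i), PowerSeries.X ^ k) *
        ∏ _i : σ, (1 - PowerSeries.X ^ 1) := by
    rw [← Finset.prod_mul_distrib]
    exact Finset.prod_congr rfl fun i _ => by rw [pow_one, geom_sum_mul_neg]
  have hleft : ((∑ j, Polynomial.X ^ e j : Polynomial ℤ) : PowerSeries ℤ) =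
      ∑ j, PowerSeries.X ^ e j := by
    simp only [← Polynomial.coeToPowerSeries.ringHom_apply, map_sum, map_pow]
    simp only [Polynomial.coeToPowerSeries.ringHom_apply, Polynomial.coe_X]
  have hright : ((∏ i, ∑ k ∈ Finset.range (w i), Polynomial.X ^ k : Polynomial ℤ) :
      PowerSeries ℤ) = ∏ i, ∑ k ∈ Finset.range (w i), PowerSeries.X ^ k := by
    simp only [← Polynomial.coeToPowerSeries.ringHom_apply, map_sum, map_prod, map_pow]
    simp only [Polynomial.coeToPowerSeries.ringHom_apply, Polynomial.coe_X]
  rw [hleft, hright]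
  calc ∑ j, PowerSeries.X ^ e j
      = (∑ j, PowerSeries.X ^ e j) *
          ((∏ i, (1 - PowerSeries.X ^ w i)) * weightSeries w) := by
        rw [prod_one_sub_mul_weightSeries w hw, mul_one]
    _ = (∏ i, (1 - PowerSeries.X ^ w i)) * ((∑ j, PowerSeries.X ^ e j) * weightSeries w) := by
        ring
    _ = (∏ i, ∑ k ∈ Finset.range (w i), PowerSeries.X ^ k) *
          ((∏ _i : σ, (1 - PowerSeries.X ^ 1)) * weightSeries fun _ : σ => 1) := by
        rw [hseries, hgeom, mul_assoc]
    _ = _ := by rw [prod_one_sub_mul_weightSeries _ fun _ => one_pos, mul_one]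

theorem AlgebraicIndependent.pos_of_isHomogeneous {K σ τ : Type*} [Field K]
    {θ : τ → MvPolynomial σ K} (hθ : AlgebraicIndependent K θ) {w : τ → ℕ}
    (hw : ∀ i, (θ i).IsHomogeneous (w i)) (i : τ) : 0 < w i := by
  rw [Nat.pos_iff_ne_zero]
  intro h
  have h0 := hw i
  rw [h, ← totalDegree_zero_iff_isHomogeneous, totalDegree_eq_zero_iff_eq_C] at h0
  apply hθ.transcendental i
  rw [h0]
  exact isAlgebraic_algebraMap _

open Polynomial in
/-- **Poincaré series identity.** If `θ₁,…,θₙ` is a hsop for the finite pseudoreflection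
group `G` with `deg θᵢ = dᵢ`, and `p₁,…,p_d` (`d = |G|`) a homogeneous basis of `ℂ[z]` over
`ℂ[z]^G` with `deg p_j = e_j`, then `Σⱼ t^{e_j} = ∏ᵢ (1 + t + ⋯ + t^{dᵢ−1})` in `ℤ[t]`. -/
theorem poincare_series_identity {n : ℕ} (G : Subgroup (GL (Fin n) ℂ)) [Finite G]
    (hG : IsPseudoreflectionGroup G)
    (θ : Fin n → MvPolynomial (Fin n) ℂ) (dd : Fin n → ℕ)
    (hθhom : ∀ i, (θ i).IsHomogeneous (dd i))
    (hθalg : AlgebraicIndependent ℂ θ)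
    (hθgen : ∀ q : MvPolynomial (Fin n) ℂ,
      (∀ σ ∈ G, polyAct σ q = q) ↔ q ∈ Algebra.adjoin ℂ (Set.range θ))
    (d : ℕ) (hd : d = Nat.card G)
    (p : Fin d → MvPolynomial (Fin n) ℂ) (ee : Fin d → ℕ)
    (hphom : ∀ j, (p j).IsHomogeneous (ee j))
    (hbasis_ex : ∀ q : MvPolynomial (Fin n) ℂ, ∃ r : Fin d → MvPolynomial (Fin n) ℂ,
      (∀ i, ∀ σ ∈ G, polyAct σ (r i) = r i) ∧ q = ∑ i, r i * p i)
    (hbasis_uniq : ∀ r r' : Fin d → MvPolynomial (Fin n) ℂ,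
      (∀ i, ∀ σ ∈ G, polyAct σ (r i) = r i) → (∀ i, ∀ σ ∈ G, polyAct σ (r' i) = r' i) →
      ∑ i, r i * p i = ∑ i, r' i * p i → r = r') :
    ∑ j : Fin d, (Polynomial.X : Polynomial ℤ) ^ (ee j) =
      ∏ i : Fin n, ∑ k ∈ Finset.range (dd i), (Polynomial.X : Polynomial ℤ) ^ k := by
  let A := Algebra.adjoin ℂ (Set.range θ)
  let bA : Module.Basis (Fin n →₀ ℕ) ℂ A :=
    (basisMonomials (Fin n) ℂ).map hθalg.aevalEquiv.toLinearEquiv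
  have hbA (a : Fin n →₀ ℕ) : (bA a : MvPolynomial (Fin n) ℂ) = ∏ i, θ i ^ a i := by
    change (hθalg.aevalEquiv (basisMonomials (Fin n) ℂ a) : MvPolynomial (Fin n) ℂ) = _
    rw [hθalg.aevalEquiv_apply_coe, MvPolynomial.coe_basisMonomials,
      MvPolynomial.aeval_monomial, map_one, one_mul, Finsupp.prod_fintype _ _ fun i => pow_zero _]
  have hli : LinearIndependent A p := by
    rw [Fintype.linearIndependent_iff]
    intro g hg
    have := hbasis_uniq (fun i => g i) (fun _ => 0) (fun i => (hθgen _).2 (g i).2)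
      (fun i => (hθgen _).2 (zero_mem _)) (by simpa [Algebra.smul_def] using hg)
    exact fun i => Subtype.ext (congrFun this i)
  have hsp : ⊤ ≤ Submodule.span A (Set.range p) := by
    intro q _
    obtain ⟨r, hr, rfl⟩ := hbasis_ex q
    exact Submodule.sum_mem _ fun i _ =>
      Submodule.smul_mem _ (⟨r i, (hθgen _).1 (hr i)⟩ : A) (Submodule.subset_span ⟨i, rfl⟩)
  refine sum_X_pow_eq_prod_of_basis dd (hθalg.pos_of_isHomogeneous hθhom) ee
    (bA.smulTower (Module.Basis.mk hli hsp)) fun x => ?_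
  rw [Module.Basis.smulTower_apply, Module.Basis.mk_apply, Algebra.smul_def]
  refine IsHomogeneous.mul ?_ (hphom _)
  change (bA x.1 : MvPolynomial (Fin n) ℂ).IsHomogeneous _
  rw [hbA]
  exact IsHomogeneous.prod _ _ _ fun i _ => (hθhom i).pow _
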